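/- For every 1 ≤ i ≤ N and every j ∈ Z/ℓ: ε_j(μ_i^{(n)}) = 1 if j ≡ n−1 (mod ℓ), and ε_j(μ_i^{(n)}) = 0 otherwise. For i = 0: ε_j(μ_0^{(n)}) = 1 if j ≡ n−1 (mod ℓ) and n ≢ 0 (mod ℓ), and ε_j(μ_0^{(n)}) = 0 otherwise. -/

import Mathlib

noncomputable section

open scoped BigOperators Classical

namespace FockCrystal

variable (ℓ : ℕ)

/-- The `ℓ`-residue of a cell `(r, c)` (0-indexed rows and columns): `(c - r) mod ℓ`. -/
def res (x : ℕ × ℕ) : ZMod ℓ := (((x.2 : ℤ) - (x.1 : ℤ) : ℤ) : ZMod ℓ)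

/-- `x` is an addable cell of `μ`: `x ∉ μ` and `μ ∪ {x}` is again a Young diagram. -/
def IsAddableCell (μ : YoungDiagram) (x : ℕ × ℕ) : Prop :=
  x ∉ μ ∧ IsLowerSet (insert x (μ.cells : Set (ℕ × ℕ)))

/-- `x` is a removable cell of `μ`: `x ∈ μ` and `μ \ {x}` is again a Young diagram. -/
def IsRemovableCell (μ : YoungDiagram) (x : ℕ × ℕ) : Prop :=
  x ∈ μ ∧ IsLowerSet ((μ.cells.erase x : Finset (ℕ × ℕ)) : Set (ℕ × ℕ))

/-- The finite set of `i`-addable cells of `μ`. -/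
def addables (i : ZMod ℓ) (μ : YoungDiagram) : Finset (ℕ × ℕ) :=
  (Finset.range (μ.cells.card + 1) ×ˢ Finset.range (μ.cells.card + 1)).filter
    fun x => IsAddableCell μ x ∧ res ℓ x = i

/-- The finite set of `i`-removable cells of `μ`. -/
def removables (i : ZMod ℓ) (μ : YoungDiagram) : Finset (ℕ × ℕ) :=
  μ.cells.filter fun x => IsRemovableCell μ x ∧ res ℓ x = i

/-- Adding a cell to a Young diagram (returns `μ` unchanged if the result would not be a
Young diagram). -/
def addCell (μ : YoungDiagram) (x : ℕ × ℕ) : YoungDiagram :=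
  if h : IsLowerSet (insert x (μ.cells : Set (ℕ × ℕ))) then
    ⟨insert x μ.cells, by simpa using h⟩
  else μ

/-- Removing a cell from a Young diagram (returns `μ` unchanged if the result would not be
a Young diagram). -/
def eraseCell (μ : YoungDiagram) (x : ℕ × ℕ) : YoungDiagram :=
  if h : IsLowerSet ((μ.cells.erase x : Finset (ℕ × ℕ)) : Set (ℕ × ℕ)) then
    ⟨μ.cells.erase x, h⟩
  else μ

/-- The letter (`some true` = `A` for addable, `some false` = `R` for removable) contributed
to the `i`-word of `μ` by row `r`; for a fixed residue a row contributes at most one letter. -/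
def rowLetter (i : ZMod ℓ) (μ : YoungDiagram) (r : ℕ) : Option Bool :=
  if ∃ c, (r, c) ∈ addables ℓ i μ then some true
  else if ∃ c, (r, c) ∈ removables ℓ i μ then some false
  else none

/-- The `i`-word of `μ`, read from the bottom row up, with each letter recorded together
with its row index. -/
def wordP (i : ZMod ℓ) (μ : YoungDiagram) : List (Bool × ℕ) :=
  ((List.range (μ.cells.card + 2)).reverse).filterMap fun r =>
    (rowLetter ℓ i μ r).map fun b => (b, r)

/-- One step of the `AR`-cancellation (stack algorithm): an `R` cancels a directly
preceding `A`. -/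
def cancelStep (st : List (Bool × ℕ)) (c : Bool × ℕ) : List (Bool × ℕ) :=
  if c.1 = false ∧ (st.getLast?.map Prod.fst) = some true then st.dropLast else st ++ [c]

/-- Repeatedly delete adjacent occurrences of `AR` until none remain (computed by the
one-pass stack algorithm, which yields the unique `AR`-reduced word `R…RA…A`). -/
def reduceWord (w : List (Bool × ℕ)) : List (Bool × ℕ) := w.foldl cancelStep []

/-- The row of the `i`-good cell of `μ`: the removable cell corresponding to the rightmost
`R` remaining in the reduced `i`-word (if any). -/
def goodRow (i : ZMod ℓ) (μ : YoungDiagram) : Option ℕ :=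
  (((reduceWord (wordP ℓ i μ)).filter fun p => p.1 = false).getLast?).map Prod.snd

/-- The row of the `i`-cogood cell of `μ`: the addable cell corresponding to the leftmost
`A` remaining in the reduced `i`-word (if any). -/
def cogoodRow (i : ZMod ℓ) (μ : YoungDiagram) : Option ℕ :=
  (((reduceWord (wordP ℓ i μ)).filter fun p => p.1 = true).head?).map Prod.snd

/-- The Kashiwara operator `ẽᵢ`: remove the `i`-good cell if there is one, else `0`
(modelled by `Option`, `none = 0`). -/
def etilde (i : ZMod ℓ) (μ : YoungDiagram) : Option YoungDiagram :=
  (goodRow ℓ i μ).map fun r => eraseCell μ (r, μ.rowLen r - 1)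

/-- The Kashiwara operator `f̃ᵢ`: add the `i`-cogood cell if there is one, else `0`
(modelled by `Option`, `none = 0`). -/
def ftilde (i : ZMod ℓ) (μ : YoungDiagram) : Option YoungDiagram :=
  (cogoodRow ℓ i μ).map fun r => addCell μ (r, μ.rowLen r)

/-- The list of row lengths of the partition `μ_i^{(n)}`:
`μ₀^{(n)} = (n)`, and for `1 ≤ i ≤ N = ⌊n/ℓ⌋`,
`μ_i^{(n)} = ((N-i)ℓ + ℓ-1, (ℓ-1)^q, s)` where `n - ((N-i)ℓ + ℓ-1) = q(ℓ-1) + s`,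
`0 ≤ s ≤ ℓ-2`, and the last part `s` is omitted when `s = 0`. -/
def muList (ℓ n i : ℕ) : List ℕ :=
  if i = 0 then [n]
  else
    ((n / ℓ - i) * ℓ + (ℓ - 1)) ::
      (List.replicate ((n - ((n / ℓ - i) * ℓ + (ℓ - 1))) / (ℓ - 1)) (ℓ - 1)
        ++ (if (n - ((n / ℓ - i) * ℓ + (ℓ - 1))) % (ℓ - 1) = 0 then []
            else [(n - ((n / ℓ - i) * ℓ + (ℓ - 1))) % (ℓ - 1)]))

/-- The `k`-fold iterate of the Kashiwara operator `ẽᵢ` (with `none = 0` absorbing). -/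
def eiter (i : ZMod ℓ) : ℕ → YoungDiagram → Option YoungDiagram
  | 0, μ => some μ
  | k + 1, μ => (etilde ℓ i μ).bind (eiter i k)

/-- `εᵢ(λ) = max { k ≥ 0 ∣ ẽᵢᵏ λ ≠ 0 }`. -/
def eps (i : ZMod ℓ) (μ : YoungDiagram) : ℕ :=
  sSup { k : ℕ | eiter ℓ i k μ ≠ none }

theorem fold_good (L : ℕ → Option Bool) (pre : List (Bool × ℕ)) (m : ℕ) :
    ∀ st : List (Bool × ℕ), (∀ p ∈ st, p.1 = true) →
    (∀ r < m, L r = some false →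
      (∃ r', r < r' ∧ r' < m ∧ L r' = some true ∧ ∀ k, r < k → k < r' → L k = none) ∨
      (st ≠ [] ∧ ∀ k, r < k → k < m → L k = none)) →
    ∃ st' : List (Bool × ℕ), (∀ p ∈ st', p.1 = true) ∧
      (((List.range m).reverse).filterMap fun r => (L r).map fun b => (b, r)).foldl
        cancelStep (pre ++ st) = pre ++ st' := by
  induction m with
  | zero => intro st h1 _; exact ⟨st, h1, by simp⟩
  | succ m ih =>
    intro st h1 h2
    rw [List.range_succ, List.reverse_append, List.reverse_singleton, List.singleton_append]
    rcases hL : L m with _ | b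
    · rw [List.filterMap_cons_none (by simp [hL])]
      apply ih st h1
      intro r hr hLr
      rcases h2 r (by omega) hLr with ⟨r', a, b, c, d⟩ | ⟨a, b⟩
      · refine Or.inl ⟨r', a, ?_, c, d⟩
        rcases Nat.lt_succ_iff_lt_or_eq.mp b with h | h
        · exact h
        · subst h; simp [hL] at c
      · exact Or.inr ⟨a, fun k hk hk' => b k hk (by omega)⟩
    · rw [List.filterMap_cons_some (b := (b, m)) (by simp [hL]), List.foldl_cons]
      cases b with
      | true =>
        have : cancelStep (pre ++ st) (true, m) = pre ++ (st ++ [(true, m)]) := by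
          simp [cancelStep]
        rw [this]
        apply ih
        · intro p hp
          rcases List.mem_append.mp hp with hp | hp
          · exact h1 p hp
          · simp at hp; simp [hp]
        intro r hr hLr
        rcases h2 r (by omega) hLr with ⟨r', a, b, c, d⟩ | ⟨a, b⟩
        · rcases Nat.lt_succ_iff_lt_or_eq.mp b with h | h
          · exact Or.inl ⟨r', a, h, c, d⟩
          · subst h
            exact Or.inr ⟨by simp, d⟩
        · have := b m hr (by omega)
          simp [hL] at this
      | false =>
        have hst : st ≠ [] := by
          rcases h2 m (by omega) hL with ⟨r', a, b, c, d⟩ | ⟨a, b⟩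
          · omega
          · exact a
        have : cancelStep (pre ++ st) (false, m) = pre ++ st.dropLast := by
          have hl : (pre ++ st).getLast?.map Prod.fst = some true := by
            rw [List.getLast?_append_of_ne_nil _ hst, List.getLast?_eq_some_getLast hst]
            simp [h1 _ (List.getLast_mem hst)]
          unfold cancelStep
          rw [if_pos ⟨rfl, hl⟩, List.dropLast_append_of_ne_nil hst]
        rw [this]
        apply ih
        · intro p hp
          exact h1 p (List.mem_of_mem_dropLast hp)
        intro r hr hLr
        rcases h2 r (by omega) hLr with ⟨r', a, b, c, d⟩ | ⟨a, b⟩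
        · rcases Nat.lt_succ_iff_lt_or_eq.mp b with h | h
          · exact Or.inl ⟨r', a, h, c, d⟩
          · subst h
            simp [hL] at c
        · have := b m hr (by omega)
          simp [hL] at this

theorem word_top (L : ℕ → Option Bool) (r0 : ℕ) (M : ℕ) (hM : r0 ≤ M)
    (h : ∀ r, r0 ≤ r → L r = none) :
    (((List.range M).reverse).filterMap fun r => (L r).map fun b => (b, r)) =
    (((List.range r0).reverse).filterMap fun r => (L r).map fun b => (b, r)) := by
  induction M, hM using Nat.le_induction with
  | base => rfl
  | succ m hm ih =>
    rw [List.range_succ, List.reverse_append, List.reverse_singleton, List.singleton_append,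
      List.filterMap_cons_none (by simp [h m hm]), ih]

theorem mem_res_of_add (μ : YoungDiagram) (r c : ℕ) :
    IsAddableCell μ (r, c) ↔ c = μ.rowLen r ∧ (r = 0 ∨ μ.rowLen r < μ.rowLen (r - 1)) := by
  constructor
  · rintro ⟨h1, h2⟩
    rw [YoungDiagram.mem_iff_lt_rowLen] at h1
    have hc : c = μ.rowLen r := by
      by_contra hne
      have := h2 (a := (r, c)) (b := (r, c - 1)) (by simp [Prod.le_def]) (by simp)
      simp only [Set.mem_insert_iff, Prod.mk.injEq, Finset.mem_coe, YoungDiagram.mem_cells,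
        YoungDiagram.mem_iff_lt_rowLen] at this
      omega
    refine ⟨hc, ?_⟩
    by_cases hr : r = 0
    · exact Or.inl hr
    right
    have := h2 (a := (r, c)) (b := (r - 1, c)) (by simp [Prod.le_def]) (by simp)
    simp only [Set.mem_insert_iff, Prod.mk.injEq, Finset.mem_coe, YoungDiagram.mem_cells,
        YoungDiagram.mem_iff_lt_rowLen] at this
    omega
  · rintro ⟨rfl, h⟩
    refine ⟨by simp [YoungDiagram.mem_iff_lt_rowLen], ?_⟩
    rintro ⟨x, y⟩ ⟨x', y'⟩ hle hm
    simp only [Prod.mk_le_mk, Set.mem_insert_iff, Prod.mk.injEq, Finset.mem_coe,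
      YoungDiagram.mem_cells, YoungDiagram.mem_iff_lt_rowLen] at *
    rcases hm with ⟨rfl, rfl⟩ | hm
    · by_cases hx : x' = x
      · subst hx; omega
      · have := μ.rowLen_anti x' (x - 1) (by omega)
        omega
    · have := μ.rowLen_anti x' x hle.1
      omega

theorem removable_iff (μ : YoungDiagram) (r c : ℕ) :
    IsRemovableCell μ (r, c) ↔ c + 1 = μ.rowLen r ∧ μ.rowLen (r + 1) < μ.rowLen r := by
  constructor
  · rintro ⟨h1, h2⟩
    rw [YoungDiagram.mem_iff_lt_rowLen] at h1
    have k1 := h2 (a := (r, c + 1)) (b := (r, c)) (by simp [Prod.le_def])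
    have k2 := h2 (a := (r + 1, c)) (b := (r, c)) (by simp [Prod.le_def])
    simp [YoungDiagram.mem_iff_lt_rowLen] at k1 k2
    omega
  · rintro ⟨hc, h⟩
    refine ⟨by rw [YoungDiagram.mem_iff_lt_rowLen]; omega, ?_⟩
    rintro ⟨x, y⟩ ⟨x', y'⟩ hle hm
    simp only [Prod.mk_le_mk, Finset.coe_erase, Set.mem_sdiff, Set.mem_singleton_iff,
      Prod.mk.injEq, Finset.mem_coe,
      YoungDiagram.mem_cells, YoungDiagram.mem_iff_lt_rowLen] at *
    have k1 := μ.rowLen_anti x' x hle.1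
    refine ⟨by omega, ?_⟩
    rintro ⟨rfl, rfl⟩
    by_cases hx : x' = x
    · subst hx; omega
    · have := μ.rowLen_anti (x' + 1) x (by omega)
      omega

theorem rowLen_le_card (μ : YoungDiagram) (r : ℕ) : μ.rowLen r ≤ μ.cells.card := by
  rw [YoungDiagram.rowLen_eq_card]
  exact Finset.card_le_card (Finset.filter_subset _ _)

theorem colLen_le_card (μ : YoungDiagram) (r : ℕ) : μ.colLen r ≤ μ.cells.card := by
  rw [YoungDiagram.colLen_eq_card]
  exact Finset.card_le_card (Finset.filter_subset _ _)

theorem row_lt_card (μ : YoungDiagram) (r : ℕ) (h : 0 < μ.rowLen r) : r < μ.cells.card := by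
  rw [← YoungDiagram.mem_iff_lt_rowLen, YoungDiagram.mem_iff_lt_colLen] at h
  exact lt_of_lt_of_le h (colLen_le_card μ 0)

/-- addable condition of row -/
def AC (j : ZMod ℓ) (f : ℕ → ℕ) (r : ℕ) : Prop :=
  (r = 0 ∨ f r < f (r - 1)) ∧ (f r : ZMod ℓ) - (r : ZMod ℓ) = j

/-- removable condition of row -/
def RC (j : ZMod ℓ) (f : ℕ → ℕ) (r : ℕ) : Prop :=
  f (r + 1) < f r ∧ (f r : ZMod ℓ) - 1 - (r : ZMod ℓ) = j

theorem ex_add (j : ZMod ℓ) (μ : YoungDiagram) (r : ℕ) :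
    (∃ c, (r, c) ∈ addables ℓ j μ) ↔ AC ℓ j μ.rowLen r := by
  unfold addables AC
  simp only [Finset.mem_filter, mem_res_of_add, Finset.mem_product, Finset.mem_range]
  simp only [res]
  constructor
  · rintro ⟨c, -, ⟨rfl, h⟩, h2⟩
    exact ⟨h, by simpa using h2⟩
  · rintro ⟨h, h2⟩
    refine ⟨_, ⟨?_, ?_⟩, ⟨rfl, h⟩, by simpa using h2⟩
    · rcases h with h | h
      · omega
      · have := row_lt_card μ (r - 1) (by omega)
        omega
    · have := rowLen_le_card μ r
      omega

theorem ex_rem (j : ZMod ℓ) (μ : YoungDiagram) (r : ℕ) :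
    (∃ c, (r, c) ∈ removables ℓ j μ) ↔ RC ℓ j μ.rowLen r := by
  unfold removables RC
  simp only [Finset.mem_filter, removable_iff, YoungDiagram.mem_cells,
    YoungDiagram.mem_iff_lt_rowLen]
  simp only [res]
  constructor
  · rintro ⟨c, h0, ⟨h1, h⟩, h2⟩
    refine ⟨h, ?_⟩
    rw [← h1, ← h2]; push_cast; ring
  · rintro ⟨h, h2⟩
    refine ⟨μ.rowLen r - 1, by omega, ⟨by omega, h⟩, ?_⟩
    rw [← h2]
    push_cast [Nat.cast_sub (show 1 ≤ μ.rowLen r by omega)]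
    ring

theorem AC_not_RC (hℓ : 2 ≤ ℓ) (j : ZMod ℓ) (f : ℕ → ℕ) (r : ℕ) (h : AC ℓ j f r) :
    ¬ RC ℓ j f r := by
  intro h'
  have : Fact (1 < ℓ) := ⟨by omega⟩
  have e1 := h.2
  have e2 := h'.2
  exact one_ne_zero (α := ZMod ℓ) (by linear_combination e1 - e2)

theorem letter_true (j : ZMod ℓ) (μ : YoungDiagram) (r : ℕ) :
    rowLetter ℓ j μ r = some true ↔ AC ℓ j μ.rowLen r := by
  unfold rowLetter
  rw [ex_add, ex_rem]
  split_ifs <;> simp_all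

theorem letter_false (hℓ : 2 ≤ ℓ) (j : ZMod ℓ) (μ : YoungDiagram) (r : ℕ) :
    rowLetter ℓ j μ r = some false ↔ RC ℓ j μ.rowLen r := by
  have := AC_not_RC ℓ hℓ j μ.rowLen r
  unfold rowLetter
  rw [ex_add, ex_rem]
  split_ifs <;> simp_all

theorem letter_none (j : ZMod ℓ) (μ : YoungDiagram) (r : ℕ) :
    rowLetter ℓ j μ r = none ↔ ¬ AC ℓ j μ.rowLen r ∧ ¬ RC ℓ j μ.rowLen r := by
  unfold rowLetter
  rw [ex_add, ex_rem]
  split_ifs <;> simp_all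

theorem etilde_none (hℓ : 2 ≤ ℓ) (j : ZMod ℓ) (μ : YoungDiagram)
    (h : ∀ r, RC ℓ j μ.rowLen r → ∃ r', r < r' ∧ AC ℓ j μ.rowLen r' ∧
      ∀ k, r < k → k < r' → ¬ AC ℓ j μ.rowLen k ∧ ¬ RC ℓ j μ.rowLen k) :
    etilde ℓ j μ = none := by
  obtain ⟨st', h1, h2⟩ := fold_good (rowLetter ℓ j μ) [] (μ.cells.card + 2) [] (by simp) (by
    intro r hr hL
    rw [letter_false ℓ hℓ] at hL
    obtain ⟨r', a, b, c⟩ := h r hL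
    refine Or.inl ⟨r', a, ?_, (letter_true ℓ j μ r').2 b, fun k x y =>
      (letter_none ℓ j μ k).2 (c k x y)⟩
    have := row_lt_card μ (r' - 1) (by rcases b.1 with h | h <;> omega)
    omega)
  unfold etilde goodRow reduceWord wordP
  simp only [List.nil_append] at h2
  rw [h2, List.filter_eq_nil_iff.2]
  · rfl
  · intro a ha
    simp [h1 a ha]

theorem etilde_some (hℓ : 2 ≤ ℓ) (j : ZMod ℓ) (μ : YoungDiagram) (r0 : ℕ)
    (h0 : RC ℓ j μ.rowLen r0)
    (ht : ∀ r, r0 < r → ¬ AC ℓ j μ.rowLen r ∧ ¬ RC ℓ j μ.rowLen r)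
    (h : ∀ r < r0, RC ℓ j μ.rowLen r → ∃ r', r < r' ∧ r' < r0 ∧ AC ℓ j μ.rowLen r' ∧
      ∀ k, r < k → k < r' → ¬ AC ℓ j μ.rowLen k ∧ ¬ RC ℓ j μ.rowLen k) :
    ∃ μ' : YoungDiagram, etilde ℓ j μ = some μ' ∧
      ∀ r, μ'.rowLen r = if r = r0 then μ.rowLen r - 1 else μ.rowLen r := by
  have hlow := (removable_iff μ r0 (μ.rowLen r0 - 1)).2 ⟨by have := h0.1; omega, h0.1⟩
  refine ⟨eraseCell μ (r0, μ.rowLen r0 - 1), ?_, ?_⟩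
  · obtain ⟨st', h1, h2⟩ := fold_good (rowLetter ℓ j μ) [(false, r0)] r0 [] (by simp) (by
      intro r hr hL
      rw [letter_false ℓ hℓ] at hL
      obtain ⟨r', a, a', b, c⟩ := h r hr hL
      exact Or.inl ⟨r', a, a', (letter_true ℓ j μ r').2 b, fun k x y =>
        (letter_none ℓ j μ k).2 (c k x y)⟩)
    have hr0 := row_lt_card μ r0 (by have := h0.1; omega)
    unfold etilde goodRow reduceWord wordP
    rw [word_top _ (r0 + 1) _ (by omega) (fun r hr => (letter_none ℓ j μ r).2 (ht r hr)),
      List.range_succ, List.reverse_append, List.reverse_singleton, List.singleton_append,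
      List.filterMap_cons_some (b := (false, r0)) (by simp [(letter_false ℓ hℓ j μ r0).2 h0]),
      List.foldl_cons]
    have : cancelStep [] (false, r0) = [(false, r0)] ++ [] := by simp [cancelStep]
    rw [this, h2, List.filter_append, (List.filter_eq_nil_iff (l := st')).2]
    · simp
    · intro a ha
      simp [h1 a ha]
  · intro r
    have hm : ∀ c, c < (eraseCell μ (r0, μ.rowLen r0 - 1)).rowLen r ↔
        c < if r = r0 then μ.rowLen r - 1 else μ.rowLen r := by
      intro c
      rw [← YoungDiagram.mem_iff_lt_rowLen]
      unfold eraseCell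
      rw [dif_pos hlow.2]
      change (r, c) ∈ μ.cells.erase _ ↔ _
      rw [Finset.mem_erase, YoungDiagram.mem_cells, YoungDiagram.mem_iff_lt_rowLen]
      simp only [ne_eq, Prod.mk.injEq]
      split_ifs with hr
      · subst hr; omega
      · simp [hr]
    have a := hm (eraseCell μ (r0, μ.rowLen r0 - 1) |>.rowLen r)
    have b := hm (if r = r0 then μ.rowLen r - 1 else μ.rowLen r)
    omega

theorem eps_zero (j : ZMod ℓ) (μ : YoungDiagram) (h : etilde ℓ j μ = none) : eps ℓ j μ = 0 := by
  have : { k : ℕ | eiter ℓ j k μ ≠ none } = {0} := by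
    ext k
    rcases k with _ | k <;> simp [eiter, h]
  rw [eps, this, csSup_singleton]

theorem eps_one (j : ZMod ℓ) (μ μ' : YoungDiagram) (h : etilde ℓ j μ = some μ')
    (h' : etilde ℓ j μ' = none) : eps ℓ j μ = 1 := by
  have : { k : ℕ | eiter ℓ j k μ ≠ none } = {0, 1} := by
    ext k
    rcases k with _ | _ | k <;> simp [eiter, h, h']
  rw [eps, this, csSup_pair]
  rfl

theorem rowLen_getD (μ : YoungDiagram) (r : ℕ) : μ.rowLen r = μ.rowLens.getD r 0 := by
  by_cases h : r < μ.rowLens.length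
  · rw [List.getD_eq_getElem _ _ h, YoungDiagram.get_rowLens]
  · rw [List.getD_eq_default _ _ (by omega)]
    rw [YoungDiagram.length_rowLens, ← YoungDiagram.mem_iff_lt_colLen,
      YoungDiagram.mem_iff_lt_rowLen] at h
    omega

/-- the row lengths of `(a, (ℓ-1)^q, s)` -/
def sh (a q s r : ℕ) : ℕ :=
  if r = 0 then a else if r ≤ q then ℓ - 1 else if r = q + 1 then s else 0

theorem sh_none (hℓ : 2 ≤ ℓ) (a q s : ℕ) (ha : ℓ - 1 ≤ a) (ha' : (a : ZMod ℓ) = -1)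
    (hs : s ≤ ℓ - 2) (j : ZMod ℓ) (hj : j ≠ (s : ZMod ℓ) - q - 2) (μ : YoungDiagram)
    (hμ : ∀ r, μ.rowLen r = sh ℓ a q s r) : etilde ℓ j μ = none := by
  have hl : ((ℓ - 1 : ℕ) : ZMod ℓ) = -1 := by
    rw [Nat.cast_sub (by omega)]; simp
  have hs1 : (s : ZMod ℓ) + 1 ≠ 0 := by
    intro h
    have h : ((s + 1 : ℕ) : ZMod ℓ) = 0 := by push_cast; exact h
    rw [ZMod.natCast_eq_zero_iff] at h
    have := Nat.le_of_dvd (by omega) h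
    omega
  have hμ' : μ.rowLen = sh ℓ a q s := funext hμ
  apply etilde_none ℓ hℓ
  rw [hμ']
  rintro r ⟨h1, h2⟩
  by_cases hq : r = q + 1
  · exfalso; apply hj
    subst hq
    simp [sh] at h2
    rw [← h2]; ring
  by_cases hq : r = q
  · subst hq
    have hv : (sh ℓ a r s r : ZMod ℓ) = -1 := by
      unfold sh; split_ifs <;> first | assumption | omega
    rw [hv] at h2
    have hs0 : 0 < s := by
      by_contra h0
      have h0 : s = 0 := by omega
      subst h0
      apply hj
      rw [← h2]; push_cast; ring
    refine ⟨r + 2, by omega, ⟨?_, ?_⟩, ?_⟩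
    · right; simp [sh]; omega
    · simp [sh]; rw [← h2]; ring
    · intro k k1 k2
      have : k = r + 1 := by omega
      subst this
      constructor
      · rintro ⟨-, h3⟩
        simp [sh] at h3
        apply hs1
        linear_combination h3 - h2
      · rintro ⟨-, h3⟩
        simp [sh] at h3
        apply hj
        rw [← h3]; ring
  by_cases h0 : r = 0
  · subst h0
    refine ⟨1, by omega, ⟨Or.inr ?_, ?_⟩, by intro k k1 k2; omega⟩
    · simpa using h1
    · have : sh ℓ a q s 1 = ℓ - 1 := by
            rw [sh, if_neg (by omega), if_pos (by omega)]
      rw [this, hl, ← h2]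
      simp [sh, ha']
  · exfalso
    unfold sh at h1
    split_ifs at h1 <;> omega

theorem row_none (hℓ : 2 ≤ ℓ) (m : ℕ) (j : ZMod ℓ) (μ : YoungDiagram)
    (hμ : ∀ r, μ.rowLen r = if r = 0 then m else 0)
    (hj : j ≠ (m : ZMod ℓ) - 1 ∨ ℓ ∣ m) : etilde ℓ j μ = none := by
  have hμ' : μ.rowLen = _ := funext hμ
  apply etilde_none ℓ hℓ
  rw [hμ']
  rintro r ⟨h1, h2⟩
  by_cases h0 : r = 0
  · subst h0
    simp at h1 h2
    rcases hj with hj | hj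
    · exact absurd h2.symm hj
    · rw [← ZMod.natCast_eq_zero_iff] at hj
      refine ⟨1, by omega, ⟨Or.inr (by simpa using h1), ?_⟩, by intro k k1 k2; omega⟩
      rw [← h2, hj]; simp
  · simp [h0] at h1

theorem row_some (hℓ : 2 ≤ ℓ) (m : ℕ) (μ : YoungDiagram)
    (hμ : ∀ r, μ.rowLen r = if r = 0 then m else 0)
    (hm : ¬ ℓ ∣ m) : eps ℓ ((m : ZMod ℓ) - 1) μ = 1 := by
  have hm0 : 0 < m := by
    rcases Nat.eq_zero_or_pos m with h | h
    · simp [h] at hm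
    · exact h
  have : Fact (1 < ℓ) := ⟨by omega⟩
  rw [← ZMod.natCast_eq_zero_iff] at hm
  have hμ' : μ.rowLen = _ := funext hμ
  obtain ⟨μ', e1, e2⟩ := etilde_some ℓ hℓ ((m : ZMod ℓ) - 1) μ 0
    (by rw [hμ']; exact ⟨by simpa using hm0, by simp⟩)
    (by
      rw [hμ']
      intro r hr
      constructor
      · rintro ⟨h1, h2⟩
        by_cases hr1 : r = 1
        · subst hr1
          simp at h2
          exact hm (by linear_combination -h2)
        · have : r - 1 ≠ 0 := by omega
          simp [this] at h1
          omega
      · rintro ⟨h1, h2⟩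
        have : r ≠ 0 := by omega
        simp [this] at h1)
    (by intro r hr; omega)
  apply eps_one ℓ _ _ _ e1
  apply row_none ℓ hℓ (m - 1)
  · intro r
    rw [e2, hμ]
    split_ifs <;> omega
  · left
    intro h
    rw [Nat.cast_sub hm0] at h
    apply one_ne_zero (α := ZMod ℓ)
    push_cast at h
    linear_combination h

theorem sh_some (hℓ : 2 ≤ ℓ) (a q s : ℕ) (ha : ℓ - 1 ≤ a) (ha' : (a : ZMod ℓ) = -1)
    (hs : s ≤ ℓ - 2) (μ : YoungDiagram)
    (hμ : ∀ r, μ.rowLen r = sh ℓ a q s r) : eps ℓ ((s : ZMod ℓ) - q - 2) μ = 1 := by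
  have : Fact (1 < ℓ) := ⟨by omega⟩
  have h10 := one_ne_zero (α := ZMod ℓ)
  have hl : ((ℓ - 1 : ℕ) : ZMod ℓ) = -1 := by
    rw [Nat.cast_sub (by omega)]; simp
  have hμ' : μ.rowLen = sh ℓ a q s := funext hμ
  have hqv : (sh ℓ a q s q : ZMod ℓ) = -1 := by
    unfold sh; split_ifs <;> first | assumption | omega
  rcases Nat.eq_zero_or_pos s with hs0 | hs0
  · subst hs0
    obtain ⟨μ', e1, e2⟩ := etilde_some ℓ hℓ (((0 : ℕ) : ZMod ℓ) - q - 2) μ q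
      (by
        rw [hμ']
        refine ⟨?_, ?_⟩
        · have hx : sh ℓ a q 0 (q + 1) = 0 := by simp [sh]
          rw [hx]
          unfold sh; split_ifs <;> omega
        · rw [hqv]; push_cast; ring)
      (by
        rw [hμ']
        intro r hr
        constructor
        · rintro ⟨h1, h2⟩
          by_cases hr1 : r = q + 1
          · subst hr1
            simp [sh] at h2
            exact h10 (by linear_combination h2)
          · unfold sh at h1; split_ifs at h1 <;> omega
        · rintro ⟨h1, h2⟩
          unfold sh at h1; split_ifs at h1 <;> omega)
      (by
        rw [hμ']
        rintro r hr ⟨h1, h2⟩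
        have hr0 : r = 0 := by
          by_contra h0
          unfold sh at h1; split_ifs at h1 <;> omega
        subst hr0
        by_cases hq1 : q = 1
        · exfalso
          subst hq1
          simp [sh, ha'] at h2
          exact h10 (by linear_combination -h2)
        · refine ⟨1, by omega, by omega, ⟨Or.inr (by simpa using h1), ?_⟩,
            by intro k k1 k2; omega⟩
          have : sh ℓ a q 0 1 = ℓ - 1 := by
            rw [sh, if_neg (by omega), if_pos (by omega)]
          rw [this, hl, ← h2]
          simp [sh, ha'])
    apply eps_one ℓ _ _ _ e1
    rcases Nat.eq_zero_or_pos q with hq | hq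
    · subst hq
      apply row_none ℓ hℓ (a - 1)
      · intro r
        rw [e2, hμ]
        unfold sh
        split_ifs <;> omega
      · left
        intro h
        rw [Nat.cast_sub (by omega), ha'] at h
        push_cast at h
        exact h10 (by linear_combination h)
    · apply sh_none ℓ hℓ a (q - 1) (ℓ - 2) ha ha' le_rfl
      · intro h
        rw [Nat.cast_sub hℓ, Nat.cast_sub hq] at h
        push_cast at h
        rw [ZMod.natCast_self] at h
        exact h10 (by linear_combination h)
      · intro r
        rw [e2, hμ]
        unfold sh
        split_ifs <;> omega
  · have hsz : (s : ZMod ℓ) ≠ 0 := by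
      intro h
      rw [ZMod.natCast_eq_zero_iff] at h
      have := Nat.le_of_dvd (by omega) h
      omega
    obtain ⟨μ', e1, e2⟩ := etilde_some ℓ hℓ ((s : ZMod ℓ) - q - 2) μ (q + 1)
      (by
        rw [hμ']
        refine ⟨?_, ?_⟩
        · simp [sh, hs0]
        · simp [sh]; ring)
      (by
        rw [hμ']
        intro r hr
        constructor
        · rintro ⟨h1, h2⟩
          by_cases hr1 : r = q + 2
          · subst hr1
            simp [sh] at h2
            exact hsz (by linear_combination -h2)
          · unfold sh at h1; split_ifs at h1 <;> omega
        · rintro ⟨h1, h2⟩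
          unfold sh at h1; split_ifs at h1 <;> omega)
      (by
        rw [hμ']
        rintro r hr ⟨h1, h2⟩
        by_cases hq : r = q
        · exfalso
          subst hq
          rw [hqv] at h2
          exact hsz (by linear_combination -h2)
        have hr0 : r = 0 := by
          by_contra h0
          unfold sh at h1; split_ifs at h1 <;> omega
        subst hr0
        refine ⟨1, by omega, by omega, ⟨Or.inr (by simpa using h1), ?_⟩,
            by intro k k1 k2; omega⟩
        have : sh ℓ a q s 1 = ℓ - 1 := by
            rw [sh, if_neg (by omega), if_pos (by omega)]
        rw [this, hl, ← h2]
        simp [sh, ha'])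
    apply eps_one ℓ _ _ _ e1
    apply sh_none ℓ hℓ a q (s - 1) ha ha' (by omega)
    · intro h
      rw [Nat.cast_sub hs0] at h
      push_cast at h
      exact h10 (by linear_combination h)
    · intro r
      rw [e2, hμ]
      unfold sh
      split_ifs <;> omega

theorem muList_getD (a q s r : ℕ) :
    (a :: (List.replicate q (ℓ - 1) ++ (if s = 0 then [] else [s]))).getD r 0 =
      sh ℓ a q s r := by
  rcases r with _ | r
  · simp [sh]
  · rw [List.getD_cons_succ]
    by_cases h : r < q
    · rw [List.getD_append _ _ _ _ (by simpa using h), List.getD_eq_getElem _ _ (by simpa using h)]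
      simp [sh]; omega
    · rw [List.getD_append_right _ _ _ _ (by simp; omega), List.length_replicate]
      unfold sh
      by_cases hr : r = q
      · subst hr
        by_cases hs : s = 0 <;> simp [hs]
      · obtain ⟨d, hd⟩ : ∃ d, r - q = d + 1 := ⟨r - q - 1, by omega⟩
        rw [hd, if_neg (show ¬ r + 1 = 0 by omega), if_neg (show ¬ r + 1 ≤ q by omega),
          if_neg (show ¬ r + 1 = q + 1 by omega)]
        split_ifs <;> simp

/-- For every `1 ≤ i ≤ N = ⌊n/ℓ⌋` and every residue `j ∈ ℤ/ℓ`: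
`εⱼ(μ_i^{(n)}) = 1` if `j ≡ n-1 (mod ℓ)` and `0` otherwise.  For `i = 0`:
`εⱼ(μ₀^{(n)}) = 1` if `j ≡ n-1 (mod ℓ)` and `ℓ ∤ n`, and `0` otherwise.
Partitions are encoded as Young diagrams and specified by their lists of row lengths. -/
theorem statement14 (n : ℕ) (hℓ : 2 ≤ ℓ) (hn : 1 ≤ n) :
    (∀ i : ℕ, 1 ≤ i → i ≤ n / ℓ →
      ∀ μ : YoungDiagram, μ.rowLens = muList ℓ n i →
        ∀ j : ZMod ℓ,
          eps ℓ j μ = if j = ((n - 1 : ℕ) : ZMod ℓ) then 1 else 0)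
    ∧ (∀ μ : YoungDiagram, μ.rowLens = muList ℓ n 0 →
        ∀ j : ZMod ℓ,
          eps ℓ j μ = if j = ((n - 1 : ℕ) : ZMod ℓ) ∧ ¬ ℓ ∣ n then 1 else 0) := by


  have hcast : ((n - 1 : ℕ) : ZMod ℓ) = (n : ZMod ℓ) - 1 := by
    rw [Nat.cast_sub hn]; simp
  rw [hcast]
  refine ⟨?_, ?_⟩
  · intro i hi hin μ hμ j
    unfold muList at hμ
    rw [if_neg (by omega)] at hμ
    set a := (n / ℓ - i) * ℓ + (ℓ - 1) with ha
    set q := (n - a) / (ℓ - 1) with hq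
    set s := (n - a) % (ℓ - 1) with hs
    have hsh : ∀ r, μ.rowLen r = sh ℓ a q s r := by
      intro r
      rw [rowLen_getD, hμ, ← muList_getD]
    have han : a ≤ n := by
      have h1 : (n / ℓ) * ℓ ≤ n := Nat.div_mul_le_self n ℓ
      have h2 : (n / ℓ - i) * ℓ + 1 * ℓ ≤ (n / ℓ) * ℓ := by
        rw [← add_mul]; exact Nat.mul_le_mul_right _ (by omega)
      omega
    have ha1 : ℓ - 1 ≤ a := by omega
    have hl : ((ℓ - 1 : ℕ) : ZMod ℓ) = -1 := by
      rw [Nat.cast_sub (by omega)]; simp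
    have ha' : (a : ZMod ℓ) = -1 := by
      rw [ha, Nat.cast_add, hl]; simp
    have hs2 : s ≤ ℓ - 2 := by
      have := Nat.mod_lt (n - a) (show 0 < ℓ - 1 by omega)
      omega
    have hnn : n = a + ((ℓ - 1) * q + s) := by
      rw [hq, hs, Nat.div_add_mod]; omega
    clear_value s q a
    have hnz : (n : ZMod ℓ) = -1 + (-1 * q + s) := by
      have h := congrArg (Nat.cast : ℕ → ZMod ℓ) hnn
      rw [Nat.cast_add, Nat.cast_add, Nat.cast_mul, hl, ha'] at h
      exact h
    have hc : (n : ZMod ℓ) - 1 = (s : ZMod ℓ) - q - 2 := by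
      rw [hnz]; ring
    rw [hc]
    split_ifs with hj
    · rw [hj]
      exact sh_some ℓ hℓ a q s ha1 ha' hs2 μ hsh
    · exact eps_zero ℓ _ _ (sh_none ℓ hℓ a q s ha1 ha' hs2 j hj μ hsh)
  · intro μ hμ j
    have hsh : ∀ r, μ.rowLen r = if r = 0 then n else 0 := by
      intro r
      rw [rowLen_getD, hμ]
      rcases r with _ | r <;> simp [muList]
    split_ifs with hj
    · rw [hj.1]
      exact row_some ℓ hℓ n μ hsh hj.2
    · apply eps_zero
      apply row_none ℓ hℓ n j μ hsh
      tauto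

end FockCrystal
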